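/- arXiv:2202.13573 — 3 statements merged into one kernel-verified Lean document; each statement's English description precedes it below -/
import Mathlib

section
/- The diagonal quaternary quadratic form x² + 2y² + 2z² + 5w² primitively represents every positive integer except exactly 12. -/
theorem Int.exists_two_mul_abs_add_mul_le (h : ℤ) {g : ℤ} (hg : 0 < g) :
    ∃ t : ℤ, 2 * |h + t * g| ≤ g := by
  have h₁ := Int.emod_add_mul_ediv h g
  have h₂ := Int.emod_nonneg h hg.ne'
  have h₃ := Int.emod_lt_of_pos h hg
  by_cases hc : 2 * (h % g) ≤ g
  · refine ⟨-(h / g), ?_⟩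
    have : h + -(h / g) * g = h % g := by linear_combination -h₁
    rw [this, abs_of_nonneg h₂]
    exact hc
  · refine ⟨-(h / g) - 1, ?_⟩
    have : h + (-(h / g) - 1) * g = h % g - g := by linear_combination -h₁
    rw [this, abs_of_nonpos (by linarith)]
    linarith

theorem Int.eq_one_of_three_mul_sq_le {a g : ℤ} (ha : 0 < a) (hg : 0 < g)
    (hag : 3 * a ^ 2 ≤ 4 * g) (hga : 3 * g ^ 2 ≤ 4 * a) : a = 1 ∧ g = 1 := by
  have ha2 : a < 2 := by
    by_contra! h
    rcases le_total a g with hle | hle <;> nlinarith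
  have hg2 : g < 2 := by
    by_contra! h
    rcases le_total a g with hle | hle <;> nlinarith
  omega

/-- Every value of a positive definite integral ternary quadratic form with even cross terms and
determinant `1` is a sum of three squares. -/
theorem exists_sum_three_sq_of_det_eq_one (a b c d e f : ℤ) (ha : 0 < a) (hg : 0 < a * b - f ^ 2)
    (hdet : a * b * c + 2 * d * e * f - a * d ^ 2 - b * e ^ 2 - c * f ^ 2 = 1) (x y z : ℤ) :
    ∃ u v w : ℤ, a * x ^ 2 + b * y ^ 2 + c * z ^ 2 + 2 * d * y * z + 2 * e * x * z + 2 * f * x * y =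
      u ^ 2 + v ^ 2 + w ^ 2 := by
  obtain ⟨t, ht⟩ := Int.exists_two_mul_abs_add_mul_le (a * d - e * f) hg
  obtain ⟨g, hgdef⟩ : ∃ g, g = a * b - f ^ 2 := ⟨_, rfl⟩
  obtain ⟨h, hh⟩ : ∃ h, h = a * d - e * f + t * (a * b - f ^ 2) := ⟨_, rfl⟩
  obtain ⟨k, hk⟩ : ∃ k, k = a * (c + 2 * t * d + t ^ 2 * b) - (e + t * f) ^ 2 := ⟨_, rfl⟩
  have hgk : g * k - h ^ 2 = a := by
    subst hgdef hh hk
    linear_combination a * hdet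
  rw [← hh, ← hgdef] at ht
  have hg' : 0 < g := hgdef ▸ hg
  have hkpos : 0 < k := by
    have : 0 < g * k := by nlinarith [sq_nonneg h]
    exact pos_of_mul_pos_right this hg'.le
  by_cases hkg : k < g
  · obtain ⟨u, v, w, H⟩ := exists_sum_three_sq_of_det_eq_one a (c + 2 * t * d + t ^ 2 * b) b
      (d + t * b) f (e + t * f) ha (hkpos.trans_eq hk) (by linear_combination hdet) x z (y - t * z)
    exact ⟨u, v, w, by linear_combination H⟩
  push Not at hkg
  have h4 : 4 * h ^ 2 ≤ g ^ 2 := by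
    have := pow_le_pow_left₀ (by positivity) ht 2
    rwa [mul_pow, sq_abs] at this
  have hga : 3 * g ^ 2 ≤ 4 * a := by nlinarith
  obtain ⟨s, hs⟩ := Int.exists_two_mul_abs_add_mul_le f ha
  obtain ⟨b', hb'⟩ : ∃ b', b' = b + 2 * s * f + s ^ 2 * a := ⟨_, rfl⟩
  have hab' : a * b' - (f + s * a) ^ 2 = g := by
    subst hb' hgdef
    ring
  have hb'pos : 0 < b' := by
    have : 0 < a * b' := by nlinarith [sq_nonneg (f + s * a)]
    exact pos_of_mul_pos_right this ha.le
  by_cases hba : b' < a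
  · obtain ⟨u, v, w, H⟩ := exists_sum_three_sq_of_det_eq_one b' a c e (d + s * e) (f + s * a)
      hb'pos (by linarith) (by subst hb'; linear_combination hdet) y (x - s * y) z
    exact ⟨u, v, w, by subst hb'; linear_combination H⟩
  push Not at hba
  have hf4 : 4 * (f + s * a) ^ 2 ≤ a ^ 2 := by
    have := pow_le_pow_left₀ (by positivity) hs 2
    rwa [mul_pow, sq_abs] at this
  have hag : 3 * a ^ 2 ≤ 4 * g := by nlinarith
  obtain ⟨ha1, hg1⟩ := Int.eq_one_of_three_mul_sq_le ha hg' hag hga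
  have hh0 : h = 0 := by
    rw [hg1] at ht
    exact abs_eq_zero.1 (by have := abs_nonneg h; omega)
  have hk1 : k = 1 := by
    rw [hg1, hh0, ha1] at hgk
    linarith
  rw [hg1] at hgdef
  rw [hh0] at hh
  rw [hk1] at hk
  subst ha1
  refine ⟨x + f * y + e * z, y - t * z, z, ?_⟩
  linear_combination (-(y - t * z) ^ 2) * hgdef - 2 * (y - t * z) * z * hh - z ^ 2 * hk
termination_by (a.toNat, (a * b - f ^ 2).toNat)
decreasing_by
  · apply Prod.Lex.right
    omega
  · apply Prod.Lex.left
    omega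

theorem exists_sum_three_sq_of_dvd_sq_add {n d r : ℤ} (hd : 0 < d) (hdn : 1 < d * n)
    (h : d * n - 1 ∣ r ^ 2 + d) : ∃ u v w : ℤ, n = u ^ 2 + v ^ 2 + w ^ 2 := by
  obtain ⟨q, hq⟩ := h
  have hqpos : 0 < q := by
    have : 0 < (d * n - 1) * q := by rw [← hq]; positivity
    exact pos_of_mul_pos_right this (by linarith)
  obtain ⟨u, v, w, H⟩ := exists_sum_three_sq_of_det_eq_one q (d * n - 1) n 0 1 r hqpos
    (by linarith) (by linear_combination (-n) * hq) 0 0 1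
  exact ⟨u, v, w, by linear_combination H⟩

theorem exists_dvd_sq_add_of_jacobiSym {p : ℕ} (hp : p.Prime) {d : ℤ} (h : jacobiSym (-d) p = 1) :
    ∃ r : ℤ, (p : ℤ) ∣ r ^ 2 + d := by
  have := Fact.mk hp
  obtain ⟨r, hr⟩ := ZMod.isSquare_of_jacobiSym_eq_one h
  obtain ⟨r, rfl⟩ := ZMod.intCast_surjective r
  refine ⟨r, ?_⟩
  rw [← ZMod.intCast_zmod_eq_zero_iff_dvd]
  push_cast at hr ⊢
  linear_combination -hr

theorem exists_sum_three_sq_of_mod_four_eq_two {n : ℕ} (hn : n % 4 = 2) :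
    ∃ u v w : ℤ, (n : ℤ) = u ^ 2 + v ^ 2 + w ^ 2 := by
  have hcop : (n - 1).Coprime (4 * n) := by
    apply Nat.Coprime.mul_right
    · exact Nat.Coprime.pow_right 2 (Nat.coprime_two_right.2 (Nat.odd_iff.2 (by omega)))
    · exact (Nat.coprime_self_sub_left (by omega)).2 (by simp)
  obtain ⟨p, hpn, hp, hmod⟩ := Nat.forall_exists_prime_gt_and_modEq n (by omega) hcop
  obtain ⟨v, hv⟩ := (Nat.modEq_iff_dvd' (by omega)).1 hmod.symm
  have hpv : (p : ℤ) = (4 * v + 1 : ℕ) * n - 1 := by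
    have : p = 4 * n * v + (n - 1) := by omega
    zify [show 1 ≤ n by omega] at this
    push_cast
    linear_combination this
  have hp4 : p % 4 = 1 := by
    have : p = 4 * (n * v) + (n - 1) := by rw [← mul_assoc]; omega
    omega
  have hJ : jacobiSym (-(4 * v + 1 : ℕ)) p = 1 := by
    rw [← neg_one_mul, jacobiSym.mul_left, jacobiSym.at_neg_one (Nat.odd_iff.2 (by omega)),
      ZMod.χ₄_nat_one_mod_four hp4, one_mul,
      jacobiSym.quadratic_reciprocity_one_mod_four (by omega) (Nat.odd_iff.2 (by omega)),
      jacobiSym.mod_left' (a₂ := -1), jacobiSym.at_neg_one (Nat.odd_iff.2 (by omega)),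
      ZMod.χ₄_nat_one_mod_four (by omega)]
    rw [hpv]
    exact Int.modEq_iff_dvd.2 ⟨-n, by ring⟩
  obtain ⟨r, hr⟩ := exists_dvd_sq_add_of_jacobiSym hp hJ
  have hp2 := hp.two_le
  exact exists_sum_three_sq_of_dvd_sq_add (by positivity) (by omega) (hpv ▸ hr)

theorem exists_sum_three_sq_of_odd {n : ℕ} (hn : n % 8 = 1 ∨ n % 8 = 3 ∨ n % 8 = 5) :
    ∃ u v w : ℤ, (n : ℤ) = u ^ 2 + v ^ 2 + w ^ 2 := by
  obtain ⟨c, hc⟩ : ∃ c, (n % 8 = 3 ∧ c = 1) ∨ ((n % 8 = 1 ∨ n % 8 = 5) ∧ c = 3) := by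
    by_cases h : n % 8 = 3
    · exact ⟨1, by omega⟩
    · exact ⟨3, by omega⟩
  obtain ⟨m, hm⟩ : ∃ m, 2 * m + 1 = c * n := by
    rcases hc with ⟨h, rfl⟩ | ⟨h, rfl⟩
    · exact ⟨n / 2, by omega⟩
    · exact ⟨3 * n / 2, by omega⟩
  have hm2 : m % 2 = 1 := by
    rcases hc with ⟨h, rfl⟩ | ⟨h, rfl⟩ <;> omega
  have hcop : m.Coprime (4 * n) := by
    apply Nat.Coprime.mul_right
    · exact Nat.Coprime.pow_right 2 (Nat.coprime_two_right.2 (Nat.odd_iff.2 hm2))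
    · rw [Nat.coprime_iff_isRelPrime]
      intro k hkm hkn
      exact Nat.isUnit_iff.2 (Nat.dvd_one.1
        ((Nat.dvd_add_right (hkm.mul_left 2)).1 (hm ▸ hkn.mul_left c)))
  obtain ⟨p, hpn, hp, hmod⟩ := Nat.forall_exists_prime_gt_and_modEq m (by omega) hcop
  obtain ⟨v, hv⟩ := (Nat.modEq_iff_dvd' hpn.le).1 hmod.symm
  have hpv' : p = 4 * (n * v) + m := by rw [← mul_assoc]; omega
  obtain ⟨d, hd⟩ : ∃ d, d = 8 * v + c := ⟨_, rfl⟩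
  have hpv : (2 * p : ℤ) = d * n - 1 := by
    zify at hm hpv' hd
    rw [hd, hpv']
    linear_combination hm
  have hd8 : d % 8 = 1 ∨ d % 8 = 3 := by omega
  have hdodd : Odd d := Nat.odd_iff.2 (by omega)
  have hpodd : Odd p := Nat.odd_iff.2 (by omega)
  have hneg : jacobiSym p d = 1 := by
    have h2 : jacobiSym (-2) d = 1 := by
      rw [jacobiSym.at_neg_two hdodd, ZMod.χ₈'_nat_eq_if_mod_eight, if_neg (by omega), if_pos hd8]
    have h4 : jacobiSym (-2 * p) d = 1 := by
      rw [jacobiSym.mod_left' (a₂ := 1), jacobiSym.one_left]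
      exact Int.modEq_iff_dvd.2 ⟨n, by linear_combination hpv⟩
    rwa [jacobiSym.mul_left, h2, one_mul] at h4
  have hJ : jacobiSym (-d) p = 1 := by
    rw [← neg_one_mul, jacobiSym.mul_left, jacobiSym.at_neg_one hpodd]
    by_cases hp4 : p % 4 = 1
    · rw [ZMod.χ₄_nat_one_mod_four hp4, one_mul,
        jacobiSym.quadratic_reciprocity_one_mod_four' hdodd hp4, hneg]
    · have hp3 : p % 4 = 3 := by omega
      have hd3 : d % 4 = 3 := by
        rcases hc with ⟨h, rfl⟩ | ⟨h, rfl⟩ <;> omega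
      rw [ZMod.χ₄_nat_three_mod_four hp3,
        jacobiSym.quadratic_reciprocity_three_mod_four hd3 hp3, hneg]
      rfl
  obtain ⟨r, hr⟩ := exists_dvd_sq_add_of_jacobiSym hp hJ
  obtain ⟨r, hr, hrodd⟩ : ∃ r : ℤ, (p : ℤ) ∣ r ^ 2 + d ∧ Odd r := by
    rcases Int.even_or_odd r with hev | hodd
    · refine ⟨r + p, ?_, hev.add_odd (by exact_mod_cast hpodd)⟩
      rw [show (r + p) ^ 2 + (d : ℤ) = r ^ 2 + d + p * (2 * r + p) by ring]
      exact dvd_add hr (dvd_mul_right _ _)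
    · exact ⟨r, hr, hodd⟩
  have h2 : (2 : ℤ) ∣ r ^ 2 + d := (hrodd.pow.add_odd (by exact_mod_cast hdodd)).two_dvd
  have h2p : (2 * p : ℤ) ∣ r ^ 2 + d := by
    refine IsCoprime.mul_dvd ?_ h2 hr
    rw [Int.isCoprime_iff_gcd_eq_one]
    exact Nat.coprime_two_left.2 hpodd
  have hp2 := hp.two_le
  exact exists_sum_three_sq_of_dvd_sq_add (by omega) (by omega) (hpv ▸ h2p)

/-- The part of **Legendre's three-square theorem** concerning numbers not divisible by `4`. -/
theorem exists_sum_three_sq {n : ℕ} (h4 : n % 4 ≠ 0) (h8 : n % 8 ≠ 7) :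
    ∃ u v w : ℤ, (n : ℤ) = u ^ 2 + v ^ 2 + w ^ 2 := by
  by_cases h : n % 4 = 2
  · exact exists_sum_three_sq_of_mod_four_eq_two h
  · exact exists_sum_three_sq_of_odd (by omega)

theorem exists_sq_add_two_mul_sq_add_two_mul_sq {n : ℕ} (h4 : n % 4 ≠ 0) (h8 : n % 8 ≠ 7) :
    ∃ x y z : ℤ, (n : ℤ) = x ^ 2 + 2 * y ^ 2 + 2 * z ^ 2 := by
  have key {u v w : ℤ} (h : Even (v + w)) :
      ∃ x y z : ℤ, u ^ 2 + v ^ 2 + w ^ 2 = x ^ 2 + 2 * y ^ 2 + 2 * z ^ 2 := by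
    obtain ⟨k, hk⟩ := h
    exact ⟨u, k, v - k, by rw [show w = 2 * k - v by linarith]; ring⟩
  obtain ⟨u, v, w, h⟩ := exists_sum_three_sq h4 h8
  rw [h]
  rcases Int.even_or_odd (v + w) with hvw | hvw
  · exact key hvw
  rcases Int.even_or_odd (u + w) with huw | huw
  · rw [add_comm (u ^ 2)]
    exact key huw
  · have huv : Even (u + v) := by
      have := hvw.add_odd huw
      grind
    rw [add_comm, ← add_assoc]
    exact key huv

theorem exists_sum_three_sq_with_odd_add {n : ℕ} (hn : n % 4 = 1 ∨ n % 4 = 2) :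
    ∃ u v w : ℤ, (n : ℤ) = u ^ 2 + v ^ 2 + w ^ 2 ∧ Odd (v + w) := by
  obtain ⟨u, v, w, h⟩ := exists_sum_three_sq (n := n) (by omega) (by omega)
  rcases Int.even_or_odd (v + w) with hvw | hvw
  · refine ⟨v, u, w, by linarith, ?_⟩
    by_contra huw
    rw [Int.not_odd_iff_even] at huw
    obtain ⟨i, hi⟩ := hvw
    obtain ⟨j, hj⟩ := huw
    have hv : v = 2 * i - w := by linarith
    have hu : u = 2 * j - w := by linarith
    have h3 : (n : ℤ) = 3 * w ^ 2 + 4 * (i ^ 2 - i * w + j ^ 2 - j * w) := by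
      rw [h, hv, hu]
      ring
    rcases Int.even_or_odd' w with ⟨m, rfl | hm⟩
    · rw [mul_pow] at h3
      omega
    · have := Int.sq_mod_four_eq_one_of_odd ⟨m, hm⟩
      omega
  · exact ⟨u, v, w, h, hvw⟩

theorem Int.gcd_eq_one_of_isCoprime_last {x y z w : ℤ}
    (h : IsCoprime x w ∨ IsCoprime y w) : Int.gcd x (Int.gcd y (Int.gcd z w)) = 1 := by
  have hx := Int.gcd_dvd_left x (Int.gcd y (Int.gcd z w))
  have hr := Int.gcd_dvd_right x (Int.gcd y (Int.gcd z w))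
  have hy := hr.trans (Int.gcd_dvd_left y (Int.gcd z w))
  have hw := (hr.trans (Int.gcd_dvd_right y (Int.gcd z w))).trans (Int.gcd_dvd_right z w)
  rcases h with h | h
  · simpa using Int.isUnit_iff_natAbs_eq.1 (h.isUnit_of_dvd' hx hw)
  · simpa using Int.isUnit_iff_natAbs_eq.1 (h.isUnit_of_dvd' hy hw)

theorem Int.isCoprime_two_pow_of_odd {x : ℤ} (hx : Odd x) (k : ℕ) : IsCoprime x (2 ^ k) :=
  IsCoprime.pow_right <| by
    rw [Int.isCoprime_iff_gcd_eq_one]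
    exact Nat.coprime_two_right.2 (Int.natAbs_odd.2 hx)

/-- The form `x² + 2y² + 2z² + 5w²` represents `n` primitively. -/
def PrimitivelyRepresented (n : ℕ) : Prop :=
  ∃ x y z w : ℤ, Int.gcd x (Int.gcd y (Int.gcd z w)) = 1 ∧
    x ^ 2 + 2 * y ^ 2 + 2 * z ^ 2 + 5 * w ^ 2 = (n : ℤ)

namespace PrimitivelyRepresented

theorem add_five {m : ℕ} (h4 : m % 4 ≠ 0) (h8 : m % 8 ≠ 7) : PrimitivelyRepresented (m + 5) := by
  obtain ⟨x, y, z, h⟩ := exists_sq_add_two_mul_sq_add_two_mul_sq h4 h8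
  refine ⟨x, y, z, 1, by simp, ?_⟩
  push_cast
  linear_combination -h

theorem add_twenty {m : ℕ} (hm : m % 4 = 1) : PrimitivelyRepresented (m + 20) := by
  obtain ⟨x, y, z, h⟩ := exists_sq_add_two_mul_sq_add_two_mul_sq (n := m) (by omega) (by omega)
  have hx : Odd x := by
    have : Odd (x ^ 2) := Int.odd_iff.2 (by omega)
    exact (Int.odd_pow' two_ne_zero).1 this
  refine ⟨x, y, z, 2 ^ 1,
    Int.gcd_eq_one_of_isCoprime_last (.inl (Int.isCoprime_two_pow_of_odd hx 1)), ?_⟩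
  push_cast
  linear_combination -h

theorem four_mul {m : ℕ} (k : ℕ) (hm : m % 4 = 1 ∨ m % 4 = 2) :
    PrimitivelyRepresented (4 * (m + 5 * (2 ^ k) ^ 2)) := by
  obtain ⟨u, v, w, h, hvw⟩ := exists_sum_three_sq_with_odd_add hm
  refine ⟨2 * u, v + w, v - w, 2 ^ (k + 1),
    Int.gcd_eq_one_of_isCoprime_last (.inr (Int.isCoprime_two_pow_of_odd hvw (k + 1))), ?_⟩
  push_cast
  linear_combination -4 * h

theorem of_mod_four_eq_one {n : ℕ} (hn : n % 4 = 1) : PrimitivelyRepresented n := by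
  by_cases h : n < 20
  · obtain rfl | rfl | rfl | rfl | rfl : n = 1 ∨ n = 5 ∨ n = 9 ∨ n = 13 ∨ n = 17 := by omega
    · exact ⟨1, 0, 0, 0, by decide, by norm_num⟩
    · exact ⟨0, 0, 0, 1, by decide, by norm_num⟩
    · exact ⟨1, 2, 0, 0, by decide, by norm_num⟩
    · exact ⟨0, 2, 0, 1, by decide, by norm_num⟩
    · exact ⟨3, 2, 0, 0, by decide, by norm_num⟩
  · obtain ⟨m, rfl⟩ := Nat.exists_eq_add_of_le' (not_lt.1 h)
    exact add_twenty (by omega)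

theorem of_mod_eight_eq_four {n : ℕ} (hn : n % 8 = 4) (h12 : n ≠ 12) :
    PrimitivelyRepresented n := by
  obtain ⟨m, rfl⟩ : ∃ m, n = 4 * m := ⟨n / 4, by omega⟩
  by_cases hm : m % 4 = 3
  · obtain ⟨l, rfl⟩ := Nat.exists_eq_add_of_le' (show 5 ≤ m by omega)
    exact four_mul 0 (by omega)
  by_cases h : m < 20
  · obtain rfl | rfl | rfl | rfl | rfl : m = 1 ∨ m = 5 ∨ m = 9 ∨ m = 13 ∨ m = 17 := by omega
    · exact ⟨0, 1, 1, 0, by decide, by norm_num⟩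
    · exact ⟨4, 1, 1, 0, by decide, by norm_num⟩
    · exact ⟨4, 3, 1, 0, by decide, by norm_num⟩
    · exact ⟨4, 3, 3, 0, by decide, by norm_num⟩
    · exact ⟨8, 1, 1, 0, by decide, by norm_num⟩
  · obtain ⟨l, rfl⟩ := Nat.exists_eq_add_of_le' (not_lt.1 h)
    exact four_mul 1 (by omega)

theorem of_ne_twelve {n : ℕ} (hn : 0 < n) (h12 : n ≠ 12) : PrimitivelyRepresented n := by
  by_cases h1 : n % 4 = 1
  · exact of_mod_four_eq_one h1
  by_cases h4 : n % 8 = 4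
  · exact of_mod_eight_eq_four h4 h12
  by_cases h : n < 5
  · obtain rfl | rfl : n = 2 ∨ n = 3 := by omega
    · exact ⟨0, 1, 0, 0, by decide, by norm_num⟩
    · exact ⟨1, 1, 0, 0, by decide, by norm_num⟩
  · obtain ⟨m, rfl⟩ := Nat.exists_eq_add_of_le' (not_lt.1 h)
    exact add_five (by omega) (by omega)

theorem not_twelve : ¬ PrimitivelyRepresented 12 := by
  rintro ⟨x, y, z, w, hgcd, h⟩
  push_cast at h
  have hx : |x| < 4 := abs_lt_of_sq_lt_sq (by nlinarith) (by norm_num)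
  have hy : |y| < 3 := abs_lt_of_sq_lt_sq (by nlinarith) (by norm_num)
  have hz : |z| < 3 := abs_lt_of_sq_lt_sq (by nlinarith) (by norm_num)
  have hw : |w| < 2 := abs_lt_of_sq_lt_sq (by nlinarith) (by norm_num)
  have key : ∀ x ∈ Finset.Ioo (-4 : ℤ) 4, ∀ y ∈ Finset.Ioo (-3 : ℤ) 3,
      ∀ z ∈ Finset.Ioo (-3 : ℤ) 3, ∀ w ∈ Finset.Ioo (-2 : ℤ) 2,
      x ^ 2 + 2 * y ^ 2 + 2 * z ^ 2 + 5 * w ^ 2 = 12 → 2 ∣ x ∧ 2 ∣ y ∧ 2 ∣ z ∧ 2 ∣ w := by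
    decide +kernel
  obtain ⟨hx2, hy2, hz2, hw2⟩ := key x (Finset.mem_Ioo.2 (abs_lt.1 hx)) y
    (Finset.mem_Ioo.2 (abs_lt.1 hy)) z (Finset.mem_Ioo.2 (abs_lt.1 hz)) w
    (Finset.mem_Ioo.2 (abs_lt.1 hw)) h
  have := Int.dvd_coe_gcd hx2 (Int.dvd_coe_gcd hy2 (Int.dvd_coe_gcd hz2 hw2))
  rw [hgcd] at this
  norm_num at this

end PrimitivelyRepresented

theorem stmt_13 (n : ℕ) (hn : 0 < n) :
    (∃ x y z w : ℤ, Int.gcd x (Int.gcd y (Int.gcd z w)) = 1 ∧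
      x ^ 2 + 2 * y ^ 2 + 2 * z ^ 2 + 5 * w ^ 2 = (n : ℤ)) ↔ n ≠ 12 := by
  refine ⟨?_, PrimitivelyRepresented.of_ne_twelve hn⟩
  rintro h rfl
  exact PrimitivelyRepresented.not_twelve h
end

section
/- Let a, b be nonnegative integers and c a positive integer with b odd, and set t = 4c − 2a² − b², assumed positive. Then the quaternary quadratic form f(x,y,z,w) = x² + 2y² + 4z² + c w² + 2b zw + 2a yw primitively represents every integer n > 16t. -/
/-- A translate of `f` by a multiple of `a` lies in `[-a/2, a/2]`. -/
theorem exists_two_mul_abs_add_mul_le {a : ℤ} (ha : 0 < a) (f : ℤ) :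
    ∃ k : ℤ, 4 * (f + k * a) ^ 2 ≤ a ^ 2 := by
  refine ⟨-((2 * f + a) / (2 * a)), ?_⟩
  have h1 := Int.emod_add_mul_ediv (2 * f + a) (2 * a)
  have h2 := Int.emod_nonneg (2 * f + a) (show 2 * a ≠ 0 by lia)
  have h3 := Int.emod_lt_of_pos (2 * f + a) (show 0 < 2 * a by lia)
  set k := (2 * f + a) / (2 * a)
  have h4 : 2 * (f + -k * a) = (2 * f + a) % (2 * a) - a := by linarith
  nlinarith

/-- Values of a positive definite integral ternary form of determinant one are sums of three
squares. -/
theorem ternary_det_one_sum_three_squares (A : ℕ) : ∀ (B : ℕ) (a b c d e f : ℤ),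
    0 < a → a ≤ A → 0 < a * b - f ^ 2 → a * b - f ^ 2 ≤ B →
    a * b * c + 2 * d * e * f - a * d ^ 2 - b * e ^ 2 - c * f ^ 2 = 1 →
    ∀ x y z : ℤ, ∃ u v w : ℤ,
      a * x ^ 2 + b * y ^ 2 + c * z ^ 2 + 2 * d * y * z + 2 * e * x * z + 2 * f * x * y
        = u ^ 2 + v ^ 2 + w ^ 2 := by
  induction A with
  | zero => intro B a b c d e f h1 h2; lia
  | succ A ihA =>
    intro B
    induction B with
    | zero => intro a b c d e f _ _ h1 h2; lia
    | succ B ihB =>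
      intro a b c d e f ha haA hD hDB hdet x y z
      push_cast at haA hDB
      -- Make `|2f| ≤ a` by a shear in the first two variables.
      wlog hf : 4 * f ^ 2 ≤ a ^ 2 generalizing b d f x
      · obtain ⟨k, hk⟩ := exists_two_mul_abs_add_mul_le ha f
        have hE : a * (b + 2 * k * f + k ^ 2 * a) - (f + k * a) ^ 2 = a * b - f ^ 2 := by ring
        obtain ⟨u, v, w, h⟩ := this (b + 2 * k * f + k ^ 2 * a) (d + k * e) (f + k * a)
          (by rw [hE]; exact hD) (by linear_combination hdet) (x - k * y)
          (by rw [hE]; exact hDB) hk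
        exact ⟨u, v, w, by rw [← h]; ring⟩
      have hb : 0 < b := by
        by_contra hb
        nlinarith [mul_nonneg ha.le (show 0 ≤ -b by lia), sq_nonneg f]
      by_cases hab : b < a
      · obtain ⟨u, v, w, h⟩ := ihA (b * a - f ^ 2).toNat b a c e d f hb (by lia) (by linarith)
          (Int.self_le_toNat _) (by linear_combination hdet) y x z
        exact ⟨u, v, w, by rw [← h]; ring⟩
      -- Make the binary form of determinant `a` in the last two variables reduced.
      wlog hE : 4 * (a * d - e * f) ^ 2 ≤ (a * b - f ^ 2) ^ 2 generalizing c d e y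
      · obtain ⟨k, hk⟩ := exists_two_mul_abs_add_mul_le hD (a * d - e * f)
        obtain ⟨u, v, w, h⟩ := this (c + 2 * k * d + k ^ 2 * b) (e + k * f) (y - k * z) (d + k * b)
          (by linear_combination hdet) (by convert hk using 3; ring)
        exact ⟨u, v, w, by rw [← h]; ring⟩
      have hDF : (a * b - f ^ 2) * (a * c - e ^ 2) - (a * d - e * f) ^ 2 = a := by
        linear_combination a * hdet
      have hF : 0 < a * c - e ^ 2 := by
        by_contra hF
        nlinarith [mul_nonneg hD.le (show 0 ≤ -(a * c - e ^ 2) by lia),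
          sq_nonneg (a * d - e * f)]
      by_cases hFD : a * c - e ^ 2 < a * b - f ^ 2
      · obtain ⟨u, v, w, h⟩ := ihB a c b d f e ha (by push_cast; lia) hF (by lia)
          (by linear_combination hdet) x z y
        exact ⟨u, v, w, by rw [← h]; ring⟩
      have h1 : 3 * a ^ 2 ≤ 4 * (a * b - f ^ 2) := by
        nlinarith [mul_le_mul_of_nonneg_left (not_lt.mp hab) ha.le]
      have h2 : 3 * (a * b - f ^ 2) ^ 2 ≤ 4 * a := by
        nlinarith [mul_le_mul_of_nonneg_left (not_lt.mp hFD) hD.le]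
      have ha1 : a = 1 := by
        by_contra hne
        have : 2 ≤ a := by lia
        have h3 : 3 * a ≤ 2 * (a * b - f ^ 2) := by nlinarith
        nlinarith
      subst ha1
      have hD1 : 1 * b - f ^ 2 = 1 := by nlinarith
      have hf0 : f = 0 := by
        have : f ^ 2 = 0 := by nlinarith [sq_nonneg f]
        exact pow_eq_zero_iff two_ne_zero |>.mp this
      subst hf0
      rw [hD1] at hE
      have hd0 : d = 0 := by
        have : d ^ 2 = 0 := by nlinarith [sq_nonneg d]
        exact pow_eq_zero_iff two_ne_zero |>.mp this
      subst hd0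
      have hb1 : b = 1 := by linarith
      subst hb1
      have hc : c = 1 + e ^ 2 := by linarith
      subst hc
      exact ⟨x + e * z, y, z, by ring⟩

/-- Every natural number congruent to `2` modulo `4` is a sum of three squares. -/
theorem sum_three_squares_of_mod_four_eq_two (m : ℕ) (hm : m % 4 = 2) :
    ∃ u v w : ℤ, (m : ℤ) = u ^ 2 + v ^ 2 + w ^ 2 := by
  have hcop : (m - 1).Coprime (4 * m) := by
    have h1 : (m - 1).Coprime m := by
      have := Nat.coprime_self_add_right (m := m - 1) (n := 1)
      rw [show m - 1 + 1 = m by lia] at this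
      simpa using this
    have h2 : (m - 1).Coprime 4 := by
      have : (m - 1).Coprime (2 ^ 2) := Nat.Coprime.pow_right 2
        (Nat.coprime_two_right.mpr (by rw [Nat.odd_iff]; lia))
      simpa using this
    exact h2.mul_right h1
  obtain ⟨p, hpm, hp, hmod⟩ :=
    Nat.forall_exists_prime_gt_and_modEq m (q := 4 * m) (a := m - 1) (by lia) hcop
  obtain ⟨j, hj⟩ : ∃ j, p = m - 1 + 4 * m * j := by
    obtain ⟨j, hj⟩ := (Nat.modEq_iff_dvd' (show m - 1 ≤ p by lia)).mp hmod.symm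
    exact ⟨j, by lia⟩
  have hpB : p + 1 = (4 * j + 1) * m := by
    have : (4 * j + 1) * m = 4 * m * j + m := by ring
    lia
  have hp4 : p % 4 = 1 := by
    have : 4 * m * j = 4 * (m * j) := by ring
    lia
  have := Fact.mk hp
  have hsym : legendreSym p (-((4 * j + 1 : ℕ) : ℤ)) = 1 := by
    rw [jacobiSym.legendreSym.to_jacobiSym, jacobiSym.neg _ (by rw [Nat.odd_iff]; lia),
      ZMod.χ₄_nat_one_mod_four hp4, one_mul,
      ← jacobiSym.quadratic_reciprocity_one_mod_four hp4 (by rw [Nat.odd_iff]; lia),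
      jacobiSym.mod_left,
      show (p : ℤ) % (4 * j + 1 : ℕ) = (-1) % (4 * j + 1 : ℕ) from ?_, ← jacobiSym.mod_left,
      jacobiSym.at_neg_one (by rw [Nat.odd_iff]; lia), ZMod.χ₄_nat_one_mod_four (by lia)]
    apply Int.ModEq.symm
    rw [Int.modEq_iff_dvd]
    exact ⟨m, by rw [sub_neg_eq_add]; exact_mod_cast hpB⟩
  have hne : ((-((4 * j + 1 : ℕ) : ℤ) : ℤ) : ZMod p) ≠ 0 := by
    intro h0
    rw [(legendreSym.eq_zero_iff p _).mpr h0] at hsym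
    exact absurd hsym (by norm_num)
  obtain ⟨r, hr⟩ := (legendreSym.eq_one_iff p hne).mp hsym
  obtain ⟨s, rfl⟩ := ZMod.intCast_surjective r
  obtain ⟨k, hk⟩ : (p : ℤ) ∣ s ^ 2 + (4 * j + 1) := by
    rw [← ZMod.intCast_zmod_eq_zero_iff_dvd]
    push_cast at hr ⊢
    linear_combination -hr
  have hp0 : (0 : ℤ) < p := by exact_mod_cast hp.pos
  have hk0 : 0 < k := by
    refine pos_of_mul_pos_right (a := (p : ℤ)) ?_ hp0.le
    rw [← hk]; positivity
  have hpB' : (p : ℤ) + 1 = (4 * j + 1) * m := by exact_mod_cast hpB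
  have hD : k * p - s ^ 2 = 4 * j + 1 := by linarith
  obtain ⟨u, v, w, h⟩ := ternary_det_one_sum_three_squares k.toNat (4 * j + 1) k p m 0 1 s
    hk0 (Int.self_le_toNat _) (by rw [hD]; positivity) (by rw [hD]; push_cast; rfl)
    (by linear_combination (m : ℤ) * hD - hpB') 0 0 1
  exact ⟨u, v, w, by rw [← h]; ring⟩

/-- Every positive odd integer has the form `(2x)² + 2y² + z²` with `z` odd. -/
theorem exists_eq_sq_add_two_mul_sq_add_sq {N : ℤ} (hN : 0 < N) (hodd : Odd N) :
    ∃ x y z : ℤ, Odd z ∧ N = (2 * x) ^ 2 + 2 * y ^ 2 + z ^ 2 := by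
  suffices h : ∃ x y z : ℤ, N = x ^ 2 + 2 * y ^ 2 + z ^ 2 by
    obtain ⟨x, y, z, h⟩ := h
    rcases Int.even_or_odd z with hz | hz
    · have hx : Odd x := by
        rw [h] at hodd
        by_contra hx
        rw [Int.not_odd_iff_even] at hx
        revert hodd
        rw [imp_false, Int.not_odd_iff_even]
        simp [Int.even_add, Int.even_pow, hx, hz]
      obtain ⟨z', rfl⟩ := hz
      exact ⟨z', y, x, hx, by rw [h]; ring⟩
    · have hx : Even x := by
        rw [h] at hodd
        by_contra hx
        revert hodd
        rw [imp_false, Int.not_odd_iff_even]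
        have hz' := Int.not_even_iff_odd.mpr hz
        simp [Int.even_add, Int.even_pow, hx, hz']
      obtain ⟨x', rfl⟩ := hx
      exact ⟨x', y, z, hz, by rw [h]; ring⟩
  have key : ∀ u v w : ℤ, 2 * N = u ^ 2 + v ^ 2 + w ^ 2 → Odd u → Odd v → Even w →
      ∃ x y z : ℤ, N = x ^ 2 + 2 * y ^ 2 + z ^ 2 := by
    rintro _ _ _ h ⟨u, rfl⟩ ⟨v, rfl⟩ ⟨w, rfl⟩
    exact ⟨u + v + 1, w, u - v, by linarith⟩
  obtain ⟨k, hk⟩ := hodd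
  obtain ⟨u, v, w, h⟩ := sum_three_squares_of_mod_four_eq_two (2 * N).toNat (by lia)
  rw [Int.toNat_of_nonneg (by lia)] at h
  have hsq : ∀ x : ℤ, (Even x ∧ x ^ 2 % 4 = 0) ∨ (Odd x ∧ x ^ 2 % 4 = 1) := by
    intro x
    rcases Int.even_or_odd x with hx | hx
    · exact .inl ⟨hx, by obtain ⟨y, rfl⟩ := hx; ring_nf; lia⟩
    · exact .inr ⟨hx, Int.sq_mod_four_eq_one_of_odd hx⟩
  rcases hsq u with ⟨hu, hu'⟩ | ⟨hu, hu'⟩ <;> rcases hsq v with ⟨hv, hv'⟩ | ⟨hv, hv'⟩ <;>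
    rcases hsq w with ⟨hw, hw'⟩ | ⟨hw, hw'⟩ <;> try (exfalso; lia)
  · exact key v w u (by linarith) hv hw hu
  · exact key u w v (by linarith) hu hw hv
  · exact key u v w h hu hv hw

theorem stmt_18 (a b c t : ℤ) (ha : 0 ≤ a) (hb : 0 ≤ b) (hc : 0 < c)
    (hbodd : Odd b) (ht : t = 4 * c - 2 * a ^ 2 - b ^ 2) (htpos : 0 < t)
    (n : ℤ) (hn : 16 * t < n) :
    ∃ x y z w : ℤ, Int.gcd x (Int.gcd y (Int.gcd z w)) = 1 ∧
      x ^ 2 + 2 * y ^ 2 + 4 * z ^ 2 + c * w ^ 2 + 2 * b * z * w + 2 * a * y * w = n := by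
  have hb4 := Int.sq_mod_four_eq_one_of_odd hbodd
  -- It suffices to take `w = 1`, completing squares in `4f`.
  obtain ⟨x, Y, Z, hZ, h⟩ := exists_eq_sq_add_two_mul_sq_add_sq (N := 4 * n - t) (by lia)
    (by rw [Int.odd_iff]; lia)
  have hZ4 := Int.sq_mod_four_eq_one_of_odd hZ
  have hY : Even (Y - a) := by
    have h2 : Even (Y ^ 2 - a ^ 2) := by
      have : (2 * x) ^ 2 = 4 * x ^ 2 := by ring
      rw [Int.even_iff]; lia
    simpa [Int.even_sub, Int.even_pow] using h2
  obtain ⟨y, hy⟩ := hY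
  obtain ⟨z, hz⟩ : ∃ z : ℤ, (4 * z + b) ^ 2 = Z ^ 2 := by
    obtain ⟨b', rfl⟩ := hbodd
    obtain ⟨Z', rfl⟩ := hZ
    rcases Int.even_or_odd (Z' - b') with ⟨k, hk⟩ | ⟨k, hk⟩
    · exact ⟨k, by rw [show Z' = b' + (k + k) by lia]; ring⟩
    · exact ⟨-(k + b' + 1), by rw [show Z' = b' + (2 * k + 1) by lia]; ring⟩
  obtain rfl : Y = 2 * y + a := by lia
  refine ⟨x, y, z, 1, by simp, ?_⟩
  subst ht
  linarith
end

section
/- Let a, b be nonnegative integers and c a positive integer with a and c even and b ≡ 2 (mod 4), and set t = 4c − 2a² − b², assumed positive. Then the quaternary quadratic form f(x,y,z,w) = x² + 2y² + 4z² + c w² + 2b zw + 2a yw primitively represents every integer n > 4t. -/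
/-- Every integer is congruent modulo `u` to one of absolute value at most `u / 2`. -/
theorem exists_add_mul_abs_le_half (s u : ℤ) (hu : 0 < u) :
    ∃ k : ℤ, -u ≤ 2 * (s + k * u) ∧ 2 * (s + k * u) ≤ u := by
  refine ⟨-((2 * s + u) / (2 * u)), ?_, ?_⟩
  · have := Int.ediv_mul_le (2 * s + u) (b := 2 * u) (by lia)
    linarith
  · have := Int.lt_ediv_add_one_mul_self (2 * s + u) (b := 2 * u) (by lia)
    linarith

/-- A positive definite integral binary quadratic form of determinant one takes only values that
are sums of two squares. -/
theorem binary_form_eq_sum_two_squares (a b c : ℤ) (ha : 0 < a) (hdet : a * c - b ^ 2 = 1)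
    (x y : ℤ) : ∃ p q : ℤ, a * x ^ 2 + 2 * b * x * y + c * y ^ 2 = p ^ 2 + q ^ 2 := by
  induction hA : a.toNat using Nat.strong_induction_on generalizing a b c x y with
  | _ A ih =>
  obtain ⟨k, hk1, hk2⟩ := exists_add_mul_abs_le_half b a ha
  set b' := b + k * a with hb'
  set c' := c + 2 * k * b + k ^ 2 * a with hc'
  have hdet' : a * c' - b' ^ 2 = 1 := by rw [hb', hc']; linear_combination hdet
  by_cases hlt : c' < a
  · have hcpos : 0 < c' := by
      by_contra! h
      nlinarith [sq_nonneg b']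
    obtain ⟨p, q, hpq⟩ := ih c'.toNat (by lia) c' b' a hcpos (by linear_combination hdet')
      y (x - k * y) rfl
    exact ⟨p, q, by rw [← hpq, hb', hc']; ring⟩
  · have hsq : 4 * b' ^ 2 ≤ a ^ 2 := by nlinarith
    have ha1 : a = 1 := by nlinarith
    refine ⟨x + b * y, y, ?_⟩
    have : c = 1 + b ^ 2 := by rw [ha1] at hdet; linarith
    rw [ha1, this]; ring

/-- A positive definite integral ternary quadratic form of determinant one takes only values that
are sums of three squares. -/
theorem ternary_form_eq_sum_three_squares (a b c d e f : ℤ) (ha : 0 < a)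
    (hg : 0 < a * d - b ^ 2)
    (hdet : a * d * f + 2 * b * c * e - a * e ^ 2 - d * c ^ 2 - f * b ^ 2 = 1) (x y z : ℤ) :
    ∃ p q r : ℤ, a * x ^ 2 + 2 * b * x * y + 2 * c * x * z + d * y ^ 2 + 2 * e * y * z + f * z ^ 2
      = p ^ 2 + q ^ 2 + r ^ 2 := by
  induction hA : a.toNat using Nat.strong_induction_on
    generalizing a b c d e f x y z with
  | _ A iha =>
  induction hG : (a * d - b ^ 2).toNat using Nat.strong_induction_on
    generalizing b c d e f x y z with
  | _ G ihg =>
  rcases eq_or_lt_of_le (show 1 ≤ a from ha) with ha1 | ha2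
  · subst ha1
    obtain ⟨p, q, hpq⟩ := binary_form_eq_sum_two_squares (d - b ^ 2) (e - b * c) (f - c ^ 2)
      (by linarith) (by linear_combination hdet) y z
    exact ⟨x + b * y + c * z, p, q, by linear_combination hpq⟩
  set g := a * d - b ^ 2 with hgdef
  obtain ⟨k, hk1, hk2⟩ := exists_add_mul_abs_le_half (a * e - b * c) g hg
  obtain ⟨l, hl1, hl2⟩ := exists_add_mul_abs_le_half b a ha
  set h := a * e - b * c + k * g with hh
  set c' := c + k * b with hc'
  set e' := e + k * d with he'
  set f' := f + 2 * k * e + k ^ 2 * d with hf'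
  have hG' : g * (a * f' - c' ^ 2) - h ^ 2 = a := by
    rw [hh, hf', hc', hgdef]; linear_combination a * hdet
  by_cases hlt : a * f' - c' ^ 2 < g
  · have hpos : 0 < a * f' - c' ^ 2 := by
      by_contra! hle
      nlinarith [sq_nonneg h]
    obtain ⟨p, q, r, hpqr⟩ := ihg (a * f' - c' ^ 2).toNat (by lia) c' b f' e' d
      hpos (by rw [hc', he', hf']; linear_combination hdet) x z (y - k * z) rfl
    exact ⟨p, q, r, by rw [← hpqr, hc', he', hf']; ring⟩
  have hsq : 4 * h ^ 2 ≤ g ^ 2 := by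
    linarith only [mul_nonneg (sub_nonneg.2 hk2) (neg_le_iff_add_nonneg.1 hk1)]
  have hga : 3 * g ^ 2 ≤ 4 * a := by
    linarith only [hsq, hG', mul_le_mul_of_nonneg_left (not_lt.1 hlt) hg.le]
  set b' := b + l * a with hb'
  set d' := d + 2 * l * b + l ^ 2 * a with hd'
  have hg' : a * d' - b' ^ 2 = g := by rw [hb', hd', hgdef]; ring
  by_cases hlt' : d' < a
  · have hpos : 0 < d' := by
      by_contra! hle
      nlinarith [sq_nonneg b']
    obtain ⟨p, q, r, hpqr⟩ := iha d'.toNat (by lia) d' b' (e + l * c) a c f hpos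
      (by linarith) (by rw [hb', hd']; linear_combination hdet) y (x - l * y) z rfl
    exact ⟨p, q, r, by rw [← hpqr, hb', hd']; ring⟩
  · exfalso
    have hsq' : 4 * b' ^ 2 ≤ a ^ 2 := by
      linarith only [mul_nonneg (sub_nonneg.2 hl2) (neg_le_iff_add_nonneg.1 hl1)]
    have hag : 3 * a ^ 2 ≤ 4 * g := by
      linarith only [hsq', hg', mul_le_mul_of_nonneg_left (not_lt.1 hlt') ha.le]
    linarith only [ha2, hg, hga, hag,
      mul_nonneg (show 0 ≤ a - 2 by lia) (show 0 ≤ 3 * a + 2 by lia),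
      mul_nonneg (show 0 ≤ g - 1 by lia) (show 0 ≤ 3 * g - 1 by lia)]

/-- Every natural number congruent to `2` modulo `4` is a sum of three squares. -/
theorem eq_sum_three_squares_of_mod_four_eq_two (n : ℕ) (hn : n % 4 = 2) :
    ∃ p q r : ℤ, (n : ℤ) = p ^ 2 + q ^ 2 + r ^ 2 := by
  have hcop : IsCoprime ((n : ℤ) - 1) ((4 * n : ℕ) : ℤ) := by
    obtain ⟨j, hj⟩ : ∃ j : ℤ, (n : ℤ) = 4 * j + 2 := ⟨n / 4, by lia⟩
    have h1 : IsCoprime ((n : ℤ) - 1) 4 := ⟨1, -j, by rw [hj]; ring⟩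
    have h2 : IsCoprime ((n : ℤ) - 1) n := ⟨-1, 1, by ring⟩
    push_cast
    exact h1.mul_right h2
  have hcop' : (n - 1).Coprime (4 * n) := by
    rw [← Nat.isCoprime_iff_coprime]
    rwa [Nat.cast_sub (by lia), Nat.cast_one]
  obtain ⟨p, hpn, hp, hmod⟩ :=
    Nat.forall_exists_prime_gt_and_modEq n (by lia) hcop'
  have := Fact.mk hp
  obtain ⟨v, hv⟩ : ∃ v : ℕ, p = (4 * v + 1) * n - 1 := by
    obtain ⟨v, hv⟩ := (Nat.modEq_iff_dvd' (by lia)).1 hmod.symm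
    refine ⟨v, ?_⟩
    have : (4 * v + 1) * n = 4 * n * v + n := by ring
    lia
  set d := 4 * v + 1 with hd
  have hpd : p + 1 = d * n := by
    have : 0 < d * n := Nat.mul_pos (by lia) (by lia)
    lia
  have hp4 : p % 4 = 1 := by
    have : (p + 1) % 4 = 2 := by rw [hpd, Nat.mul_mod, hn, hd]; lia
    lia
  have hd4 : d % 4 = 1 := by lia
  have hdp : jacobiSym d p = 1 := by
    rw [jacobiSym.quadratic_reciprocity_one_mod_four hd4 (Nat.odd_iff.2 (by lia)),
      jacobiSym.mod_left' (a₂ := -1), jacobiSym.at_neg_one (Nat.odd_iff.2 (by lia)),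
      ZMod.χ₄_nat_one_mod_four hd4]
    refine Int.ModEq.symm (Int.modEq_iff_dvd.2 ⟨n, ?_⟩)
    have : (p : ℤ) + 1 = d * n := by exact_mod_cast hpd
    linarith
  have hsq : IsSquare (((-d : ℤ)) : ZMod p) := by
    apply ZMod.isSquare_of_jacobiSym_eq_one
    rw [jacobiSym.neg _ (Nat.odd_iff.2 (by lia)), hdp, ZMod.χ₄_nat_one_mod_four hp4, one_mul]
  obtain ⟨s, hs⟩ := hsq
  obtain ⟨s, rfl⟩ := ZMod.intCast_surjective s
  obtain ⟨u, hu⟩ : (p : ℤ) ∣ s * s - (-d) := by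
    rw [← ZMod.intCast_eq_intCast_iff_dvd_sub]
    rw [hs]; push_cast; ring
  have hp0 : (0 : ℤ) < p := by exact_mod_cast hp.pos
  have hd0 : (0 : ℤ) < d := by lia
  have hu0 : 0 < u := by
    by_contra! h
    nlinarith [mul_self_nonneg s]
  have hpd' : (p : ℤ) + 1 = d * n := by exact_mod_cast hpd
  obtain ⟨x, y, z, h⟩ := ternary_form_eq_sum_three_squares u s 1 p 0 n hu0
    (by linarith) (by linear_combination (-(n : ℤ)) * hu - hpd') 0 0 1
  exact ⟨x, y, z, by rw [← h]; ring⟩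

/-- Every odd positive integer `m` is of the form `x ^ 2 + y ^ 2 + 2 * z ^ 2`
with `x` odd and `y` even. -/
theorem exists_sq_add_sq_add_two_mul_sq_of_odd (m : ℤ) (hm : 0 < m) (hodd : Odd m) :
    ∃ x y z : ℤ, Odd x ∧ Even y ∧ m = x ^ 2 + y ^ 2 + 2 * z ^ 2 := by
  have two_same_parity : ∀ p q r : ℤ, 2 * m = p ^ 2 + q ^ 2 + r ^ 2 → Even r →
      ∃ x y z : ℤ, Odd x ∧ Even y ∧ m = x ^ 2 + y ^ 2 + 2 * z ^ 2 := by
    intro p q r h hr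
    obtain ⟨z, rfl⟩ := hr
    have hpq : Even (p + q) := by
      have : Even (p ^ 2 + q ^ 2) := ⟨m - 2 * z ^ 2, by linear_combination -h⟩
      simpa [Int.even_add, Int.even_pow] using this
    obtain ⟨x, hx⟩ := hpq
    obtain rfl : p = x + x - q := by linarith
    have hm' : m = x ^ 2 + (x - q) ^ 2 + 2 * z ^ 2 := by linarith
    rcases Int.even_or_odd x with hxe | hxo
    · refine ⟨x - q, x, z, ?_, hxe, by linarith⟩
      rw [hm'] at hodd
      by_contra hne
      rw [Int.not_odd_iff_even] at hne
      rw [← Int.not_even_iff_odd] at hodd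
      exact hodd (((hxe.pow_of_ne_zero two_ne_zero).add (hne.pow_of_ne_zero two_ne_zero)).add
        (even_two_mul _))
    · refine ⟨x, x - q, z, hxo, ?_, hm'⟩
      rw [hm'] at hodd
      by_contra hne
      rw [Int.not_even_iff_odd] at hne
      rw [← Int.not_even_iff_odd] at hodd
      exact hodd ((hxo.pow.add_odd hne.pow).add (even_two_mul _))
  obtain ⟨k, hk⟩ := hodd
  obtain ⟨p, q, r, h⟩ := eq_sum_three_squares_of_mod_four_eq_two (2 * m).toNat (by lia)
  rw [Int.toNat_of_nonneg (by lia)] at h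
  have hpar : Even (p ^ 2 + q ^ 2 + r ^ 2) := ⟨m, by linarith⟩
  by_cases hr : Even r
  · exact two_same_parity p q r h hr
  by_cases hq : Even q
  · exact two_same_parity p r q (by linarith) hq
  by_cases hp : Even p
  · exact two_same_parity r q p (by linarith) hp
  · simp [Int.even_add, Int.even_pow, hr, hq, hp] at hpar

theorem stmt_19 (a b c t : ℤ) (ha : 0 ≤ a) (hb : 0 ≤ b) (hc : 0 < c)
    (haeven : Even a) (hceven : Even c) (hb4 : b % 4 = 2)
    (ht : t = 4 * c - 2 * a ^ 2 - b ^ 2) (htpos : 0 < t)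
    (n : ℤ) (hn : 4 * t < n) :
    ∃ x y z w : ℤ, Int.gcd x (Int.gcd y (Int.gcd z w)) = 1 ∧
      x ^ 2 + 2 * y ^ 2 + 4 * z ^ 2 + c * w ^ 2 + 2 * b * z * w + 2 * a * y * w = n := by
  obtain ⟨a, rfl⟩ := haeven
  obtain ⟨j, rfl⟩ : ∃ j : ℤ, b = 2 * (2 * j + 1) := ⟨b / 4, by lia⟩
  obtain ⟨T, hT⟩ : ∃ T : ℤ, T = c - 2 * a ^ 2 - (2 * j + 1) ^ 2 := ⟨_, rfl⟩
  have htT : t = 4 * T := by rw [ht, hT]; ring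
  have hTodd : Odd T := by
    obtain ⟨i, rfl⟩ := hceven
    exact ⟨i - a ^ 2 - 2 * j ^ 2 - 2 * j - 1, by rw [hT]; ring⟩
  rcases Int.even_or_odd n with hne | hno
  · obtain ⟨Z, x, Y, ⟨i, rfl⟩, -, h⟩ :=
      exists_sq_add_sq_add_two_mul_sq_of_odd (n - T) (by lia) (hne.sub_odd hTodd)
    exact ⟨x, Y - a, i - j, 1, by simp, by linear_combination -h - hT⟩
  · obtain ⟨x, Z, Y, hx, ⟨i, rfl⟩, h⟩ :=
      exists_sq_add_sq_add_two_mul_sq_of_odd (n - 4 * T) (by lia)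
        (hno.sub_even ((by decide : Even (4 : ℤ)).mul_right T))
    refine ⟨x, Y - 2 * a, i - (2 * j + 1), 2, ?_, by linear_combination -h - 4 * hT⟩
    have hx2 : IsCoprime x 2 := by
      obtain ⟨k, rfl⟩ := hx
      exact ⟨1, -k, by ring⟩
    rw [← Int.isCoprime_iff_gcd_eq_one]
    refine hx2.of_isCoprime_of_dvd_right ?_
    exact (Int.gcd_dvd_right _ _).trans (Int.gcd_dvd_right _ _)
end
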